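/- Let G be a relatively free group of infinite rank κ, formalized as G = FreeGroup X ⧸ V with X infinite and V fully invariant, let X̄ be the basis of G given by the images of the generators, let Γ = Aut G, and let Σ be a subgroup of Γ such that the cardinality of the coset space Γ/Σ is at most κ = #X. Then there is a subset U of X̄ of cardinality strictly less than κ such that for every moiety Z = {z_i : i ∈ I} of X̄ ∖ U and every family (v_i)_{i ∈ I} of elements of the subgroup ⟨U⟩ generated by U, Σ contains an automorphism σ of G satisfying σ(x) = x for all x ∈ X̄ ∖ Z and σ(z_i) = z_i·v_i for all i ∈ I. -/

import Mathlib

open Cardinal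

/-- The basis of the relatively free group `FreeGroup X ⧸ V` given by the images of
the generators. -/
def genBasis {X : Type*} (V : Subgroup (FreeGroup X)) : Set (FreeGroup X ⧸ V) :=
  Set.range fun x : X => (QuotientGroup.mk (FreeGroup.of x) : FreeGroup X ⧸ V)

universe u

/-- Diagonal argument: a subgroup of small index, pulled back to a product of groups, projects
onto one of the factors. -/
theorem exists_factor_of_index_le {ι : Type u} {P : ι → Type*} [∀ i, Group (P i)]
    {Γ : Type u} [Group Γ] (H : Subgroup Γ) (hH : #(Γ ⧸ H) ≤ #ι) (φ : (∀ i, P i) →* Γ) :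
    ∃ i, ∀ g : P i, ∃ p, p i = g ∧ φ p ∈ H := by
  classical
  obtain ⟨c⟩ := hH
  have key : ∃ q : Γ ⧸ H, ∀ g : P (c q), ∃ p, p (c q) = g ∧ (φ p : Γ ⧸ H) = q := by
    by_contra! hcon
    choose g hg using hcon
    let p : ∀ i, P i := fun i => if h : ∃ q, c q = i then h.choose_spec ▸ g h.choose else 1
    have hp : ∀ q, p (c q) = g q := by
      intro q
      have h : ∃ q', c q' = c q := ⟨q, rfl⟩
      have hq : h.choose = q := c.injective h.choose_spec
      simp only [p, dif_pos h]
      generalize_proofs h1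
      generalize h.choose = q' at hq h1
      subst hq
      rfl
    exact hg (φ p : Γ ⧸ H) p (hp _) rfl
  obtain ⟨q, hq⟩ := key
  obtain ⟨p₀, h₀, h₀'⟩ := hq 1
  refine ⟨c q, fun g => ?_⟩
  obtain ⟨p, h, h'⟩ := hq g
  refine ⟨p₀⁻¹ * p, by simp [h₀, h], ?_⟩
  rw [map_mul, map_inv, ← QuotientGroup.eq, h₀', h']

theorem exists_mulSingle_commutator_mem {ι : Type u} {P : Type*} [Group P] [DecidableEq ι]
    {Γ : Type u} [Group Γ] (H : Subgroup Γ) (hH : #(Γ ⧸ H) ≤ #ι) (φ : (ι × ι → P) →* Γ) :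
    ∃ i, ∀ a b : P, φ (Pi.mulSingle i (a * b * a⁻¹ * b⁻¹)) ∈ H := by
  have row : ∀ α : ι, ∃ β : ι, ∀ g : P, ∃ p : ι → P, p β = g ∧
      φ (fun x => if x.1 = α then p x.2 else 1) ∈ H := fun α =>
    exists_factor_of_index_le H hH (φ.comp
      { toFun := fun (p : ι → P) x => if x.1 = α then p x.2 else 1
        map_one' := by ext x; simp
        map_mul' := fun p q => by ext x; by_cases h : x.1 = α <;> simp [h] })
  choose β hβ using row
  obtain ⟨α, hα⟩ := exists_factor_of_index_le H hH (φ.comp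
      { toFun := fun (p : ι → P) x => if x.2 = β x.1 then p x.1 else 1
        map_one' := by ext x; simp
        map_mul' := fun p q => by ext x; by_cases h : x.2 = β x.1 <;> simp [h] })
  refine ⟨(α, β α), fun a b => ?_⟩
  obtain ⟨p, rfl, hp⟩ := hβ α a
  obtain ⟨q, rfl, hq⟩ := hα b
  have := H.mul_mem (H.mul_mem (H.mul_mem hp hq) (H.inv_mem hp)) (H.inv_mem hq)
  simp only [MonoidHom.comp_apply, MonoidHom.coe_mk, OneHom.coe_mk, ← map_inv, ← map_mul] at this
  convert this using 2
  ext ⟨x, y⟩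
  by_cases hx : x = α
  · subst hx
    by_cases hy : y = β x
    · subst hy; simp
    · simp [hy]
  · simp [hx]

theorem exists_perm_eqOn {X : Type u} {R : Set X} {k : X → X} (hk : Set.InjOn k R)
    (h : #(Rᶜ : Set X) = #((k '' R)ᶜ : Set X)) : ∃ g : Equiv.Perm X, Set.EqOn g k R := by
  classical
  obtain ⟨e⟩ := Cardinal.eq.1 h
  refine ⟨(Equiv.Set.sumCompl R).symm.trans
    ((Equiv.sumCongr (Equiv.Set.imageOfInjOn k R hk) e).trans (Equiv.Set.sumCompl (k '' R))),
    fun x hx => ?_⟩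
  simp [Equiv.Set.sumCompl_symm_apply_of_mem hx, Equiv.Set.imageOfInjOn]

theorem exists_perm_eqOn_of_subset {X : Type u} {A S : Set X} {f : X → X} (hf : Set.InjOn f S)
    (hSA : S ⊆ A) (hfA : Set.MapsTo f S A) (h₁ : #X ≤ #(A \ S : Set X))
    (h₂ : #X ≤ #(A \ f '' S : Set X)) :
    ∃ g : Equiv.Perm X, (∀ x ∉ A, g x = x) ∧ Set.EqOn g f S := by
  classical
  let k : X → X := fun x => if x ∈ S then f x else x
  have hkS : ∀ x ∈ S, k x = f x := fun x hx => if_pos hx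
  have hkA : ∀ x ∉ A, k x = x := fun x hx => if_neg fun h => hx (hSA h)
  have hinj : Set.InjOn k (S ∪ Aᶜ) := by
    rintro x (hx | hx) y (hy | hy) hxy
    · exact hf hx hy (by rwa [hkS x hx, hkS y hy] at hxy)
    · rw [hkS x hx, hkA y hy] at hxy
      exact absurd (hxy ▸ hfA hx) hy
    · rw [hkA x hx, hkS y hy] at hxy
      exact absurd (hxy ▸ hfA hy) hx
    · rwa [hkA x hx, hkA y hy] at hxy
  have himg : k '' (S ∪ Aᶜ) = f '' S ∪ Aᶜ := by
    rw [Set.image_union, Set.image_congr hkS,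
      Set.image_congr (g := id) (s := Aᶜ) (fun x hx => hkA x hx), Set.image_id]
  have hc : ∀ T : Set X, (T ∪ Aᶜ)ᶜ = A \ T := fun T => by ext; simp [and_comm]
  obtain ⟨g, hg⟩ := exists_perm_eqOn hinj (by
    rw [himg, hc, hc]
    exact ((mk_set_le _).antisymm h₁).trans ((mk_set_le _).antisymm h₂).symm)
  exact ⟨g, fun x hx => (hg (Or.inr hx)).trans (hkA x hx),
    fun x hx => (hg (Or.inl hx)).trans (hkS x hx)⟩

theorem exists_injective_forall_mem {X : Type u} {S : Set X} (hS : #X ≤ #S) :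
    ∃ f : X → X, Function.Injective f ∧ ∀ x, f x ∈ S := by
  obtain ⟨e⟩ := hS
  exact ⟨fun x => e x, Subtype.val_injective.comp e.injective, fun x => (e x).2⟩

theorem exists_subset_halving {X : Type u} [Infinite X] {S : Set X} (hS : #X ≤ #S) :
    ∃ T ⊆ S, #X ≤ #T ∧ #X ≤ #(S \ T : Set X) := by
  obtain ⟨f, hf, hfS⟩ := exists_injective_forall_mem hS
  have : #(X ⊕ X) = #X := by simp
  obtain ⟨e⟩ := Cardinal.eq.1 this
  refine ⟨Set.range fun x => f (e (.inl x)), ?_, ?_, ?_⟩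
  · rintro _ ⟨x, rfl⟩; exact hfS _
  · exact (mk_range_eq _ (hf.comp (e.injective.comp Sum.inl_injective))).ge
  · refine mk_le_of_injective (f := fun x => ⟨f (e (.inr x)), hfS _, ?_⟩) ?_
    · rintro ⟨y, hy⟩
      simpa using e.injective (hf hy)
    · intro x y hxy
      exact Sum.inr_injective (e.injective (hf (congrArg Subtype.val hxy)))

/-- `H` contains every permutation supported on `A`. -/
def ContainsPerms {X : Type*} (H : Subgroup (Equiv.Perm X)) (A : Set X) : Prop :=
  ∀ g : Equiv.Perm X, (∀ x ∉ A, g x = x) → g ∈ H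

theorem ContainsPerms.conj {X : Type*} {H : Subgroup (Equiv.Perm X)} {A : Set X}
    (hA : ContainsPerms H A) {h : Equiv.Perm X} (hh : h ∈ H) : ContainsPerms H (h '' A) := by
  intro g hg
  have : h⁻¹ * g * h ∈ H := hA _ fun x hx => by
    simp [hg (h x) (by simpa using hx)]
  simpa [mul_assoc] using H.mul_mem (H.mul_mem hh this) (H.inv_mem hh)

theorem ContainsPerms.mem_of_fixes {X : Type u} {H : Subgroup (Equiv.Perm X)}
    {A A' D : Set X} (hA : ContainsPerms H A) (hA' : ContainsPerms H A') (hD : D ⊆ A ∩ A')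
    (h₁ : #X ≤ #D) (h₂ : #X ≤ #((A ∩ A') \ D : Set X)) {g : Equiv.Perm X}
    (hg : ∀ x ∉ A ∪ A', g x = x) (hgD : ∀ x ∈ D, g x = x) : g ∈ H := by
  obtain ⟨f, hf, hfS⟩ := exists_injective_forall_mem h₂
  obtain ⟨a, ha, haf⟩ := exists_perm_eqOn_of_subset (A := A') (S := A' \ D) hf.injOn
    Set.sdiff_subset (fun x _ => (hfS x).1.2)
    (h₁.trans (mk_le_mk_of_subset fun x hx => ⟨(hD hx).2, fun h => h.2 hx⟩))
    (h₁.trans (mk_le_mk_of_subset fun x hx => ⟨(hD hx).2, by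
      rintro ⟨y, -, rfl⟩; exact (hfS y).2 hx⟩))
  have haH : a ∈ H := hA' a ha
  have : a * g * a⁻¹ ∈ H := hA _ fun x hx => by
    have hx' : g (a.symm x) = a.symm x := by
      by_cases hxA' : a.symm x ∈ A'
      · by_cases hxD : a.symm x ∈ D
        · exact hgD _ hxD
        · have := haf ⟨hxA', hxD⟩
          rw [Equiv.apply_symm_apply] at this
          exact absurd (this ▸ (hfS _).1.1) hx
      · have := ha _ hxA'
        rw [Equiv.apply_symm_apply] at this
        exact hg _ fun h => h.elim (fun h => hx (this ▸ h)) hxA'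
    rw [Equiv.Perm.mul_apply, Equiv.Perm.mul_apply, Equiv.Perm.coe_inv, hx', Equiv.apply_symm_apply]
  simpa [mul_assoc] using H.mul_mem (H.mul_mem (H.inv_mem haH) this) haH

theorem ContainsPerms.union {X : Type u} [Infinite X] {H : Subgroup (Equiv.Perm X)}
    {A A' : Set X} (hA : ContainsPerms H A) (hA' : ContainsPerms H A')
    (hAA' : #X ≤ #(A ∩ A' : Set X)) : ContainsPerms H (A ∪ A') := by
  intro g hg
  have himg : ∀ x ∈ A ∪ A', g x ∈ A ∪ A' := fun x hx => by
    by_contra h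
    rw [g.injective (hg _ h)] at h; exact h hx
  wlog hbig : #X ≤ #(g '' (A ∩ A') ∩ A : Set X) generalizing A A'
  · refine this hA' hA (Set.inter_comm A A' ▸ hAA') (Set.union_comm A A' ▸ hg)
      (Set.union_comm A A' ▸ himg) ?_
    by_contra hsmall
    have hlt := add_lt_of_lt (aleph0_le_mk X) (not_le.1 hbig) (not_le.1 hsmall)
    refine hlt.not_ge ((hAA'.trans_eq (mk_image_eq g.injective).symm).trans
      ((mk_le_mk_of_subset ?_).trans (mk_union_le _ _)))
    rintro _ ⟨x, hx, rfl⟩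
    rcases himg x (Or.inl hx.1) with h | h
    · exact Or.inl ⟨⟨x, hx, rfl⟩, h⟩
    · exact Or.inr ⟨⟨x, hx.symm, rfl⟩, h⟩
  obtain ⟨E, hE, hE₁, hE₂⟩ := exists_subset_halving hbig
  have hmem : ∀ y ∈ g '' (A ∩ A') ∩ A, g.symm y ∈ A ∩ A' := by
    rintro _ ⟨⟨x, hx, rfl⟩, -⟩
    simpa using hx
  have hE₃ : #X ≤ #((A ∩ A') \ (g.symm '' E) : Set X) := by
    refine (hE₂.trans_eq (mk_image_eq g.symm.injective).symm).trans
      (mk_le_mk_of_subset ?_)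
    rintro _ ⟨y, hy, rfl⟩
    refine ⟨hmem y hy.1, ?_⟩
    rintro ⟨z, hz, hzy⟩
    exact hy.2 (g.symm.injective hzy ▸ hz)
  obtain ⟨h, hhA, hhE⟩ := exists_perm_eqOn_of_subset (A := A) (S := E) (f := g.symm)
    g.symm.injective.injOn (fun x hx => (hE hx).2) (fun x hx => (hmem x (hE hx)).1)
    (hE₂.trans (mk_le_mk_of_subset fun x hx => ⟨hx.1.2, hx.2⟩))
    (hE₃.trans (mk_le_mk_of_subset fun x hx => ⟨hx.1.1, hx.2⟩))
  have hhg : h * g ∈ H := by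
    refine hA.mem_of_fixes hA' (D := g.symm '' E) ?_
      (hE₁.trans_eq (mk_image_eq g.symm.injective).symm) hE₃ ?_ ?_
    · rintro _ ⟨y, hy, rfl⟩
      exact hmem y (hE hy)
    · intro x hx
      rw [Equiv.Perm.mul_apply, hg x hx, hhA x fun h => hx (Or.inl h)]
    · rintro _ ⟨y, hy, rfl⟩
      rw [Equiv.Perm.mul_apply, Equiv.apply_symm_apply, hhE hy]
  simpa using H.mul_mem (H.inv_mem (hA h hhA)) hhg

/-- The permutation of `ι × W` acting on the block over `i` through `p i`. -/
def blockPerm (ι W : Type*) : (ι → Equiv.Perm W) →* Equiv.Perm (ι × W) where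
  toFun p :=
    { toFun := fun x => (x.1, p x.1 x.2)
      invFun := fun x => (x.1, (p x.1).symm x.2)
      left_inv := fun x => by simp
      right_inv := fun x => by simp }
  map_one' := rfl
  map_mul' _ _ := rfl

@[simp]
theorem blockPerm_apply {ι W : Type*} (p : ι → Equiv.Perm W) (x : ι × W) :
    blockPerm ι W p x = (x.1, p x.1 x.2) := rfl

/-- The permutation of `ℤ × Y` moving each level one step up. -/
def levelShift (Y : Type*) : Equiv.Perm (ℤ × Y) where
  toFun x := (x.1 + 1, x.2)
  invFun x := (x.1 - 1, x.2)
  left_inv x := by simp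
  right_inv x := by simp

@[simp]
theorem levelShift_symm_apply {Y : Type*} (x : ℤ × Y) :
    (levelShift Y).symm x = (x.1 - 1, x.2) := rfl

theorem levelShift_apply {Y : Type*} (x : ℤ × Y) : levelShift Y x = (x.1 + 1, x.2) := rfl

theorem mulSingle_level_eq_commutator {Y : Type*} (g : Equiv.Perm Y) :
    blockPerm ℤ Y (Pi.mulSingle 0 g) =
      blockPerm ℤ Y (fun n => if 0 ≤ n then g else 1) * levelShift Y *
        (blockPerm ℤ Y (fun n => if 0 ≤ n then g else 1))⁻¹ * (levelShift Y)⁻¹ := by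
  rw [← map_inv]
  ext ⟨n, y⟩ : 1
  simp only [Equiv.Perm.mul_apply, Equiv.Perm.coe_inv, levelShift_symm_apply, blockPerm_apply,
    levelShift_apply, Pi.inv_apply, sub_add_cancel]
  rcases lt_trichotomy n 0 with h | rfl | h
  · simp [h.ne, h.not_ge, show ¬ (1 ≤ n) by lia]
  · simp [← Equiv.Perm.inv_def]
  · simp [h.ne', h.le, show 1 ≤ n by lia]

theorem exists_containsPerms {X : Type u} [Infinite X] (H : Subgroup (Equiv.Perm X))
    (hH : #(Equiv.Perm X ⧸ H) ≤ #X) :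
    ∃ A : Set X, #X ≤ #A ∧ #X ≤ #(Aᶜ : Set X) ∧ ContainsPerms H A := by
  classical
  have hcard : #X = #((X × X) × (ℤ × X)) := by simp
  obtain ⟨e⟩ := Cardinal.eq.1 hcard
  obtain ⟨i, hi⟩ := exists_mulSingle_commutator_mem (P := Equiv.Perm (ℤ × X)) H hH
    ((e.symm.permCongrHom : Equiv.Perm _ →* Equiv.Perm X).comp (blockPerm (X × X) (ℤ × X)))
  have hlevel : ∀ n : ℤ, Function.Injective fun x => e.symm (i, n, x) := fun n x y h => by
    simpa using h
  refine ⟨Set.range fun x => e.symm (i, 0, x), (mk_range_eq _ (hlevel 0)).ge,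
    (mk_range_eq _ (hlevel 1)).ge.trans (mk_le_mk_of_subset ?_), fun g hg => ?_⟩
  · rintro _ ⟨x, rfl⟩ ⟨y, hy⟩
    simp at hy
  have hmem : ∀ x, (g (e.symm (i, 0, x))) ∈ Set.range fun x => e.symm (i, 0, x) := fun x => by
    by_contra h
    have := g.injective (hg _ h)
    rw [this] at h
    exact h ⟨x, rfl⟩
  have hmem' : ∀ x, (g.symm (e.symm (i, 0, x))) ∈ Set.range fun x => e.symm (i, 0, x) :=
    fun x => by
      by_contra h
      have := hg _ h
      rw [Equiv.apply_symm_apply] at this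
      rw [← this] at h
      exact h ⟨x, rfl⟩
  choose k hk using hmem
  choose k' hk' using hmem'
  let g' : Equiv.Perm X :=
    { toFun := k
      invFun := k'
      left_inv := fun x => hlevel 0 (by simp [hk, hk'])
      right_inv := fun x => hlevel 0 (by simp [hk, hk']) }
  have := hi (blockPerm ℤ X (fun n => if 0 ≤ n then g' else 1)) (levelShift X)
  rw [← mulSingle_level_eq_commutator] at this
  convert this
  ext x
  obtain ⟨⟨j, n, y⟩, rfl⟩ := e.symm.surjective x
  by_cases hj : j = i
  · subst hj
    by_cases hn : n = 0
    · subst hn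
      simpa [g'] using (hk y).symm
    · simpa [hn] using hg _ (by simp [Ne.symm hn])
  · simpa [hj] using hg _ (by simp [Ne.symm hj])

theorem exists_map_agreeing_rarely {X : Type u} [Infinite X] (F : X → X → X) :
    ∃ f : X → X, ∀ i, #{x | F i x = f x} < #X := by
  obtain ⟨r, wo, hr⟩ := exists_ord_eq X
  have hlt : ∀ x, #{y | r y x} < #X := fun x => card_typein_lt x hr
  have hex : ∀ x, ∃ z, ∀ y, r y x → F y x ≠ z := fun x => by
    by_contra! h
    refine (hlt x).not_ge ((mk_le_of_surjective (f := fun y : {y | r y x} => F y x) ?_))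
    intro z
    obtain ⟨y, hy, h⟩ := h z
    exact ⟨⟨y, hy⟩, h⟩
  choose f hf using hex
  refine ⟨f, fun i => ?_⟩
  refine (mk_le_mk_of_subset (t := insert i {y | r y i}) fun x hx => ?_).trans_lt
    (mk_insert_le.trans_lt (add_lt_of_lt (aleph0_le_mk X) (hlt i)
      (one_lt_aleph0.trans_le (aleph0_le_mk X))))
  rcases trichotomous_of r i x with h | h | h
  · exact absurd hx (hf x i h)
  · exact Or.inl h.symm
  · exact Or.inr h

/-- A subgroup of small index in a symmetric group contains the pointwise stabilizer of a small
set (Dixon, Neumann and Thomas). -/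
theorem exists_small_compl_containsPerms {X : Type u} [Infinite X] (H : Subgroup (Equiv.Perm X))
    (hH : #(Equiv.Perm X ⧸ H) ≤ #X) :
    ∃ U : Set X, #U < #X ∧ ContainsPerms H Uᶜ := by
  classical
  obtain ⟨A, hA, hAc, hAH⟩ := exists_containsPerms H hH
  have hcard : #X = #((X × X) ⊕ X) := by simp
  obtain ⟨e⟩ := Cardinal.eq.1 hcard
  let graph : (X → X) → Set X := fun f => Set.range fun x => e.symm (.inl (x, f x))
  have hinj : ∀ f : X → X, Function.Injective fun x => e.symm (.inl (x, f x)) :=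
    fun f x y h => by simpa using congrArg Prod.fst (Sum.inl_injective (e.symm.injective h))
  have hinr : Function.Injective fun x => e.symm (.inr x) :=
    e.symm.injective.comp Sum.inr_injective
  have hg : ∀ f, ∃ g : Equiv.Perm X, g '' Aᶜ = graph f := fun f => by
    obtain ⟨b⟩ := Cardinal.eq.1 ((mk_set_le (Aᶜ)).antisymm hAc)
    let k : X → X := fun x => if h : x ∈ Aᶜ then e.symm (.inl (b ⟨x, h⟩, f (b ⟨x, h⟩))) else x
    have hk : ∀ x (h : x ∈ Aᶜ), k x = e.symm (.inl (b ⟨x, h⟩, f (b ⟨x, h⟩))) :=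
      fun x h => dif_pos h
    have himg : k '' Aᶜ = graph f := by
      ext y
      constructor
      · rintro ⟨x, hx, rfl⟩
        exact ⟨b ⟨x, hx⟩, (hk x hx).symm⟩
      · rintro ⟨x, rfl⟩
        exact ⟨b.symm x, (b.symm x).2, by simp [hk _ (b.symm x).2]⟩
    obtain ⟨g, hg⟩ := exists_perm_eqOn (R := Aᶜ) (k := k) (fun x hx y hy hxy => by
        rw [hk x hx, hk y hy] at hxy
        simpa using b.injective (hinj f hxy)) (by
        rw [himg, compl_compl]
        refine le_antisymm (((mk_set_le _).trans (mk_range_eq _ hinr).ge).trans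
          (mk_le_mk_of_subset ?_)) ((mk_set_le _).trans hA)
        rintro _ ⟨x, rfl⟩ ⟨y, hy⟩
        simp at hy)
    exact ⟨g, (Set.image_congr hg).trans himg⟩
  choose g hg using hg
  obtain ⟨c⟩ := hH
  let F : X → X → X := fun i =>
    if h : ∃ f : X → X, c (g f : Equiv.Perm X ⧸ H) = i then h.choose else id
  obtain ⟨f, hf⟩ := exists_map_agreeing_rarely F
  have hF : (g (F (c (g f : Equiv.Perm X ⧸ H))) : Equiv.Perm X ⧸ H) = g f := by
    have h : ∃ f' : X → X, c (g f' : Equiv.Perm X ⧸ H) = c (g f : Equiv.Perm X ⧸ H) := ⟨f, rfl⟩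
    simp only [F, dif_pos h]
    exact c.injective h.choose_spec
  replace hf := hf (c (g f : Equiv.Perm X ⧸ H))
  generalize F (c (g f : Equiv.Perm X ⧸ H)) = f' at hf hF
  have hh : (g f')⁻¹ * g f ∈ H := QuotientGroup.eq.1 hF
  have hgA : ∀ f x, x ∈ A ↔ g f x ∉ graph f := fun f x => by
    rw [← hg f, (g f).injective.mem_set_image, Set.mem_compl_iff, not_not]
  have hA' : ∀ x, x ∈ ⇑((g f')⁻¹ * g f) '' A ↔ g f' x ∉ graph f := fun x => by
    constructor
    · rintro ⟨y, hy, rfl⟩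
      simpa using (hgA f y).1 hy
    · intro hx
      refine ⟨(g f).symm (g f' x), (hgA f _).2 (by simpa using hx), by simp⟩
  refine ⟨(A ∪ ⇑((g f')⁻¹ * g f) '' A)ᶜ, ?_, ?_⟩
  · refine lt_of_le_of_lt ?_ hf
    rw [← mk_image_eq (g f').injective, ← mk_image_eq (s := {x | f' x = f x}) (hinj f)]
    refine mk_le_mk_of_subset ?_
    rintro _ ⟨x, hx, rfl⟩
    rw [Set.mem_compl_iff, Set.mem_union, hA' x, hgA f' x, not_or, not_not, not_not] at hx
    obtain ⟨⟨y, hy⟩, ⟨z, hz⟩⟩ := hx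
    obtain ⟨rfl, h⟩ : z = y ∧ f z = f' y := by
      simpa using hz.trans hy.symm
    exact ⟨z, h.symm, hz⟩
  · rw [compl_compl]
    refine hAH.union (hAH.conj hh) ?_
    rw [← mk_image_eq (g f').injective]
    refine (mk_range_eq _ hinr).ge.trans (mk_le_mk_of_subset ?_)
    rintro _ ⟨x, rfl⟩
    refine ⟨(g f').symm (e.symm (.inr x)), ⟨(hgA f' _).2 ?_, (hA' _).2 ?_⟩, by simp⟩ <;>
    · rw [Equiv.apply_symm_apply]
      rintro ⟨y, hy⟩
      simp at hy

theorem transvection_mem_of_equivariant {Y : Type u} [Infinite Y] {W : Type*} [Group W]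
    {Γ : Type u} [Group Γ] (H : Subgroup Γ) (hH : #(Γ ⧸ H) ≤ #Y)
    (R : Equiv.Perm Y →* Γ) (T : (Y → W) →* Γ) (hR : ∀ g, R g ∈ H)
    (hRT : ∀ g w, R g * T w * (R g)⁻¹ = T (w ∘ g.symm)) {Z : Set Y} (hZ : #Y ≤ #Z)
    (hZc : #Y ≤ #(Zᶜ : Set Y)) {w : Y → W} (hw : ∀ y ∉ Z, w y = 1) : T w ∈ H := by
  classical
  have hcard : #Y = #(Y × (ℤ × Y)) := by simp
  obtain ⟨e⟩ := Cardinal.eq.1 hcard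
  obtain ⟨i, hi⟩ := exists_factor_of_index_le (P := fun _ : Y => ℤ × Y → W) H hH (T.comp
    { toFun := fun p y => p (e y).1 (e y).2
      map_one' := rfl
      map_mul' := fun _ _ => rfl })
  have hlevel : ∀ n : ℤ, Function.Injective fun x => e.symm (i, n, x) := fun n x y h => by
    simpa using h
  let L : Set Y := Set.range fun x => e.symm (i, 0, x)
  obtain ⟨b⟩ := Cardinal.eq.1 ((mk_set_le Z).antisymm hZ)
  let k : Y → Y := fun x => if h : x ∈ Z then e.symm (i, 0, b ⟨x, h⟩) else x
  have hk : ∀ x (h : x ∈ Z), k x = e.symm (i, 0, b ⟨x, h⟩) := fun x h => dif_pos h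
  have himg : k '' Z = L := by
    ext y
    constructor
    · rintro ⟨x, hx, rfl⟩
      exact ⟨b ⟨x, hx⟩, (hk x hx).symm⟩
    · rintro ⟨x, rfl⟩
      exact ⟨b.symm x, (b.symm x).2, by simp [hk _ (b.symm x).2]⟩
  obtain ⟨g, hg⟩ := exists_perm_eqOn (R := Z) (k := k) (fun x hx y hy hxy => by
      rw [hk x hx, hk y hy] at hxy
      simpa using b.injective (hlevel 0 hxy)) (by
      rw [himg]
      refine le_antisymm (((mk_set_le _).trans (mk_range_eq _ (hlevel 1)).ge).trans
        (mk_le_mk_of_subset ?_)) ((mk_set_le _).trans hZc)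
      rintro _ ⟨x, rfl⟩ ⟨y, hy⟩
      simp at hy)
  have hgL : ∀ y ∉ L, w (g.symm y) = 1 := fun y hy => hw _ fun h => hy <| by
    rw [← himg, ← Set.image_congr hg]
    exact ⟨_, h, g.apply_symm_apply y⟩
  suffices h : T (w ∘ g.symm) ∈ H by
    rw [← hRT] at h
    have := H.mul_mem (H.mul_mem (H.inv_mem (hR g)) h) (hR g)
    simpa [mul_assoc] using this
  obtain ⟨p, hpi, hp⟩ := hi fun x => if 0 ≤ x.1 then w (g.symm (e.symm (i, 0, x.2))) else 1
  let s : Equiv.Perm Y := e.symm.permCongr (blockPerm Y (ℤ × Y) (Pi.mulSingle i (levelShift Y)))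
  let f : Y → W := fun y => p (e y).1 (e y).2
  have : T (f * (f ∘ s.symm)⁻¹) ∈ H := by
    rw [map_mul, map_inv, ← hRT]
    exact H.mul_mem hp (H.inv_mem (H.mul_mem (H.mul_mem (hR s) hp) (H.inv_mem (hR s))))
  convert this using 2
  ext y
  obtain ⟨⟨j, n, y⟩, rfl⟩ := e.symm.surjective y
  have hs : s.symm (e.symm (j, n, y)) = e.symm (j, if j = i then n - 1 else n, y) := by
    rw [Equiv.symm_apply_eq]
    by_cases hj : j = i
    · subst hj; simp [s, levelShift_apply]
    · simp [s, hj]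
  simp only [f, Function.comp_apply, Pi.mul_apply, Pi.inv_apply, hs, Equiv.apply_symm_apply]
  by_cases hj : j = i
  · subst hj
    simp only [if_true, hpi]
    rcases lt_trichotomy n 0 with h | rfl | h
    · rw [hgL _ (by simp [L, h.ne'])]
      simp [h.not_ge, show ¬ (1 ≤ n) by lia]
    · simp
    · rw [hgL _ (by simp [L, h.ne])]
      simp [h.le, show 1 ≤ n by lia]
  · rw [hgL _ (by simp [L, Ne.symm hj])]
    simp [hj]

section RelativelyFree

variable {X : Type u}

/-- The image of a generator in a quotient of a free group. -/
def quotGen (V : Subgroup (FreeGroup X)) (x : X) : FreeGroup X ⧸ V := QuotientGroup.mk (FreeGroup.of x)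

theorem quotGen_mem_genBasis (V : Subgroup (FreeGroup X)) (x : X) : quotGen V x ∈ genBasis V :=
  ⟨x, rfl⟩

variable {V : Subgroup (FreeGroup X)} [V.Normal]

theorem monoidHom_ext_quotGen {M : Type*} [Monoid M] {f g : FreeGroup X ⧸ V →* M}
    (h : ∀ x, f (quotGen V x) = g (quotGen V x)) : f = g :=
  QuotientGroup.monoidHom_ext _ (FreeGroup.ext_hom _ _ h)

theorem exists_end_quotGen (hV : ∀ f : FreeGroup X →* FreeGroup X, V.map f ≤ V)
    (φ : X → FreeGroup X ⧸ V) :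
    ∃ f : FreeGroup X ⧸ V →* FreeGroup X ⧸ V, ∀ x, f (quotGen V x) = φ x := by
  choose ψ hψ using fun x => QuotientGroup.mk_surjective (φ x)
  refine ⟨QuotientGroup.map V V (FreeGroup.lift ψ) (Subgroup.map_le_iff_le_comap.1 (hV _)),
    fun x => ?_⟩
  rw [← hψ, quotGen, QuotientGroup.map_mk, FreeGroup.lift_apply_of]

theorem quotGen_injective (hV : ∀ f : FreeGroup X →* FreeGroup X, V.map f ≤ V)
    [Nontrivial (FreeGroup X ⧸ V)] : Function.Injective (quotGen V) := by
  classical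
  intro x y hxy
  by_contra hne
  obtain ⟨a, ha⟩ := exists_ne (1 : FreeGroup X ⧸ V)
  obtain ⟨f, hf⟩ := exists_end_quotGen hV fun z => if z = x then a else 1
  have h := congrArg f hxy
  rw [hf, hf, if_pos rfl, if_neg (Ne.symm hne)] at h
  exact ha h

/-- A homomorphism from a group into automorphisms, given by its action on the generators. -/
theorem exists_monoidHom_mulAut (hV : ∀ f : FreeGroup X →* FreeGroup X, V.map f ≤ V)
    {P : Type*} [Group P] (a : P → X → FreeGroup X ⧸ V) (h₁ : ∀ x, a 1 x = quotGen V x)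
    (h₂ : ∀ (p q : P) (f : FreeGroup X ⧸ V →* FreeGroup X ⧸ V),
      (∀ x, f (quotGen V x) = a p x) → ∀ x, f (a q x) = a (p * q) x) :
    ∃ T : P →* MulAut (FreeGroup X ⧸ V), ∀ p x, T p (quotGen V x) = a p x := by
  choose E hE using fun p => exists_end_quotGen hV (a p)
  have hmul : ∀ p q, (E p).comp (E q) = E (p * q) := fun p q => monoidHom_ext_quotGen fun x => by
    rw [MonoidHom.comp_apply, hE, hE, h₂ p q _ (hE p)]
  have hone : E 1 = MonoidHom.id _ := monoidHom_ext_quotGen fun x => by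
    rw [hE, h₁, MonoidHom.id_apply]
  refine ⟨MonoidHom.mk' (fun p => (E p).toMulEquiv (E p⁻¹)
    (by rw [hmul, inv_mul_cancel, hone]) (by rw [hmul, mul_inv_cancel, hone])) fun p q => ?_, hE⟩
  ext x
  exact (DFunLike.congr_fun (hmul p q) x).symm

theorem exists_permHom (hV : ∀ f : FreeGroup X →* FreeGroup X, V.map f ≤ V) :
    ∃ R : Equiv.Perm X →* MulAut (FreeGroup X ⧸ V),
      ∀ g x, R g (quotGen V x) = quotGen V (g x) :=
  exists_monoidHom_mulAut hV (fun (g : Equiv.Perm X) x => quotGen V (g x)) (fun _ => rfl) fun _ q _ hf x =>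
    hf (q x)

theorem exists_transvectionHom (hV : ∀ f : FreeGroup X →* FreeGroup X, V.map f ≤ V)
    (U : Set X) :
    ∃ T : ((Uᶜ : Set X) → Subgroup.closure (quotGen V '' U)) →* MulAut (FreeGroup X ⧸ V),
      (∀ w, ∀ x ∈ U, T w (quotGen V x) = quotGen V x) ∧
      ∀ w (x : (Uᶜ : Set X)), T w (quotGen V x) = quotGen V x * w x := by
  classical
  obtain ⟨T, hT⟩ := exists_monoidHom_mulAut hV
    (P := (Uᶜ : Set X) → Subgroup.closure (quotGen V '' U))
    (fun w x => quotGen V x * if h : x ∈ Uᶜ then (w ⟨x, h⟩ : FreeGroup X ⧸ V) else 1)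
    (fun x => by simp) (fun p q f hf x => by
      have hfix : ∀ y ∈ Subgroup.closure (quotGen V '' U), f y = y := by
        intro y hy
        refine MonoidHom.eqOn_closure (f := f) (g := MonoidHom.id _) ?_ hy
        rintro _ ⟨x, hx, rfl⟩
        simp [hf, hx]
      rw [map_mul, hf]
      by_cases h : x ∈ U
      · simp [h]
      · simp [h, hfix, mul_assoc])
  exact ⟨T, fun w x hx => by simp [hT, hx], fun w x => by
    rw [hT, dif_pos x.2]⟩

end RelativelyFree

theorem mk_quotient_comap_le {Γ Γ' : Type u} [Group Γ] [Group Γ'] (f : Γ →* Γ')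
    (H : Subgroup Γ') : #(Γ ⧸ H.comap f) ≤ #(Γ' ⧸ H) := by
  refine mk_le_of_injective (f := Quotient.map' f fun a b hab => ?_) ?_
  · rw [QuotientGroup.leftRel_apply] at hab ⊢
    simpa using hab
  · rintro ⟨a⟩ ⟨b⟩ hab
    have : (f a : Γ' ⧸ H) = f b := hab
    refine QuotientGroup.eq.2 ?_
    simpa using QuotientGroup.eq.1 this

/-- If `G = FreeGroup X ⧸ V` is a relatively free group of infinite rank `κ = #X`
(`V` fully invariant) and `Σ` is a subgroup of `Γ = Aut G` with `|Γ/Σ| ≤ κ`, then there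
is a subset `U` of the basis `X̄` with `#U < κ` such that for every moiety `Z` of
`X̄ \ U` and every family `(v_z)_{z ∈ Z}` of elements of `⟨U⟩`, `Σ` contains an
automorphism `σ` of `G` fixing `X̄ \ Z` pointwise with `σ z = z * v_z` for all `z ∈ Z`. -/
theorem small_index_subgroup_contains_transvections
    {X : Type*} [Infinite X] (V : Subgroup (FreeGroup X)) [V.Normal]
    (hV : ∀ f : FreeGroup X →* FreeGroup X, V.map f ≤ V)
    (Sg : Subgroup (MulAut (FreeGroup X ⧸ V)))
    (hSg : Cardinal.mk (MulAut (FreeGroup X ⧸ V) ⧸ Sg) ≤ Cardinal.mk X) :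
    ∃ U : Set (FreeGroup X ⧸ V),
      U ⊆ genBasis V ∧
      Cardinal.mk U < Cardinal.mk X ∧
      ∀ Z : Set (FreeGroup X ⧸ V), Z ⊆ genBasis V \ U →
        Cardinal.mk Z = Cardinal.mk (((genBasis V \ U) \ Z : Set (FreeGroup X ⧸ V))) →
        ∀ v : Z → FreeGroup X ⧸ V, (∀ z : Z, v z ∈ Subgroup.closure U) →
          ∃ σ ∈ Sg,
            (∀ x ∈ genBasis V \ Z, σ x = x) ∧
            ∀ z : Z, σ (z : FreeGroup X ⧸ V) = (z : FreeGroup X ⧸ V) * v z := by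
  classical
  rcases subsingleton_or_nontrivial (FreeGroup X ⧸ V) with hG | hG
  · exact ⟨∅, Set.empty_subset _, by simp [pos_iff_ne_zero], fun Z _ _ v _ =>
      ⟨1, Sg.one_mem, fun _ _ => rfl, fun _ => Subsingleton.elim _ _⟩⟩
  have hinj := quotGen_injective hV
  obtain ⟨R, hR⟩ := exists_permHom hV
  obtain ⟨U, hU, hUR⟩ := exists_small_compl_containsPerms (Sg.comap R)
    ((mk_quotient_comap_le R Sg).trans hSg)
  obtain ⟨T, hTU, hT⟩ := exists_transvectionHom hV U
  have hY : #(Uᶜ : Set X) = #X := mk_compl_of_infinite U hU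
  have : Infinite (Uᶜ : Set X) := by
    rw [infinite_iff, hY]
    exact aleph0_le_mk X
  refine ⟨quotGen V '' U, ?_, mk_image_le.trans_lt hU, fun Z hZ hcard v hv => ?_⟩
  · rintro _ ⟨x, -, rfl⟩
    exact quotGen_mem_genBasis V x
  let Z' : Set (Uᶜ : Set X) := {y | quotGen V y ∈ Z}
  have hinjY : Function.Injective fun y : (Uᶜ : Set X) => quotGen V y :=
    hinj.comp Subtype.val_injective
  have hZ' : #Z' = #Z := by
    rw [← mk_image_eq hinjY]
    congr 2
    ext z
    constructor
    · rintro ⟨y, hy, rfl⟩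
      exact hy
    · intro hz
      obtain ⟨⟨x, rfl⟩, hx⟩ := hZ hz
      exact ⟨⟨x, fun h => hx ⟨x, h, rfl⟩⟩, hz, rfl⟩
  have hZc' : #(Z'ᶜ : Set _) = #((genBasis V \ (quotGen V '' U)) \ Z : Set _) := by
    rw [← mk_image_eq hinjY]
    congr 2
    ext z
    constructor
    · rintro ⟨y, hy, rfl⟩
      exact ⟨⟨quotGen_mem_genBasis V _, fun h => y.2 ((hinj.mem_set_image).1 h)⟩, hy⟩
    · rintro ⟨⟨⟨x, rfl⟩, hx⟩, hz⟩
      exact ⟨⟨x, fun h => hx ⟨x, h, rfl⟩⟩, hz, rfl⟩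
  have hZZ : #Z' = #(Z'ᶜ : Set _) := by rw [hZ', hZc', hcard]
  have hsum := mk_sum_compl Z'
  rw [← hZZ] at hsum
  have hZinf : ℵ₀ ≤ #Z' := by
    by_contra! h
    exact (add_lt_aleph0 h h).not_ge ((aleph0_le_mk _).trans_eq hsum.symm)
  rw [add_eq_self hZinf] at hsum
  let w : (Uᶜ : Set X) → Subgroup.closure (quotGen V '' U) := fun y =>
    if h : quotGen V y ∈ Z then ⟨v ⟨_, h⟩, hv _⟩ else 1
  have hTw : T w ∈ Sg := by
    refine transvection_mem_of_equivariant Sg (hSg.trans hY.ge)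
      (R.comp Equiv.Perm.ofSubtype) T (fun g => ?_) (fun g u => ?_) hsum.ge (hZZ ▸ hsum).ge
      (Z := Z') (fun y hy => dif_neg hy)
    · exact hUR _ fun x hx => Equiv.Perm.ofSubtype_apply_of_not_mem _ hx
    · have hgU : ∀ x ∈ U, Equiv.Perm.ofSubtype g x = x := fun x hx =>
        Equiv.Perm.ofSubtype_apply_of_not_mem g (not_not.2 hx)
      have hfix : ∀ y ∈ Subgroup.closure (quotGen V '' U), R (Equiv.Perm.ofSubtype g) y = y := by
        intro y hy
        refine MonoidHom.eqOn_closure (f := (R (Equiv.Perm.ofSubtype g)).toMonoidHom)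
          (g := MonoidHom.id _) ?_ hy
        rintro _ ⟨x, hx, rfl⟩
        exact (hR _ x).trans (congrArg _ (hgU x hx))
      rw [MonoidHom.comp_apply, mul_inv_eq_iff_eq_mul]
      refine MulEquiv.toMonoidHom_injective (monoidHom_ext_quotGen fun x => ?_)
      simp only [MulEquiv.coe_toMonoidHom, MulAut.mul_apply, hR]
      by_cases hx : x ∈ U
      · rw [hTU _ x hx, hR, hgU x hx, hTU _ x hx]
      · rw [hT u ⟨x, hx⟩, map_mul, hR, hfix _ (u _).2]
        have hgx : Equiv.Perm.ofSubtype g x = g ⟨x, hx⟩ :=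
          Equiv.Perm.ofSubtype_apply_of_mem g hx
        rw [hgx, hT, Function.comp_apply, Equiv.symm_apply_apply]
  refine ⟨T w, hTw, ?_, ?_⟩
  · rintro _ ⟨⟨x, rfl⟩, hx⟩
    by_cases hxU : x ∈ U
    · exact hTU w x hxU
    · refine (hT w ⟨x, hxU⟩).trans ?_
      have : w ⟨x, hxU⟩ = 1 := dif_neg hx
      rw [this]
      exact mul_one _
  · rintro ⟨z, hz⟩
    obtain ⟨⟨x, rfl⟩, hx⟩ := hZ hz
    have hxU : x ∉ U := fun h => hx ⟨x, h, rfl⟩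
    refine (hT w ⟨x, hxU⟩).trans ?_
    have : (w ⟨x, hxU⟩ : FreeGroup X ⧸ V) = v ⟨_, hz⟩ := congrArg Subtype.val (dif_pos hz)
    rw [this]
    rfl
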